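/- Let α be a contact form on ℝ³ whose Reeb vector field R_α is complete, let (r, θ) be polar coordinates on ℝ², and let D²(R₀) = {r ≤ R₀} ⊂ ℝ². Then for every R₀ > 0 there exists a contact embedding of (ℝ³ × D²(R₀), ker(α + r² dθ)) into the contactization of the symplectization CS(ℝ³, α) = (ℝ³ × ℝ⁺(t) × ℝ(s), ker(tα − ds)). -/

import Mathlib

/-!
STATEMENT 9: For a contact form α on ℝ³ with complete Reeb field and any R₀ > 0,
there is a contact embedding of (ℝ³ × D²(R₀), ker(α + r²dθ)) into the
contactization of the symplectization CS(ℝ³, α) = (ℝ³ × ℝ⁺(t) × ℝ(s), ker(tα - ds)).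
In Cartesian coordinates on the disk factor, r²dθ = x dy - y dx.
-/

noncomputable section

abbrev V3 : Type := Fin 3 → ℝ

def e3 (i : Fin 3) : V3 := Pi.single i 1

def d2 {E : Type*} [NormedAddCommGroup E] [NormedSpace ℝ E]
    (α : E → E →L[ℝ] ℝ) (x v w : E) : ℝ :=
  fderiv ℝ α x v w - fderiv ℝ α x w v

def IsContactForm3 (α : V3 → V3 →L[ℝ] ℝ) : Prop :=
  ContDiff ℝ (⊤ : ℕ∞) α ∧ ∀ p : V3,
    α p (e3 0) * d2 α p (e3 1) (e3 2)
      - α p (e3 1) * d2 α p (e3 0) (e3 2)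
      + α p (e3 2) * d2 α p (e3 0) (e3 1) ≠ 0

/-- ℝ³ × ℝ⁺(t) × ℝ(s) -/
def posT : Set (V3 × ℝ × ℝ) := {q | 0 < q.2.1}

/-- ℝ³ × D²(R₀) -/
def diskS (R₀ : ℝ) : Set (V3 × ℝ × ℝ) := {q | q.2.1 ^ 2 + q.2.2 ^ 2 ≤ R₀ ^ 2}

section OmegaLemma

/-- Post-composition of continuous maps on a compact space with a continuous map. -/
def postc {K E F : Type} [TopologicalSpace K] [CompactSpace K]
    [NormedAddCommGroup E] [NormedSpace ℝ E] [NormedAddCommGroup F] [NormedSpace ℝ F]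
    (f : E → F) (hf : Continuous f) (γ : C(K, E)) : C(K, F) :=
  (ContinuousMap.mk f hf).comp γ

/-- Pointwise application as a bounded bilinear map on spaces of continuous maps. -/
def pwApply (K E F : Type) [TopologicalSpace K] [CompactSpace K]
    [NormedAddCommGroup E] [NormedSpace ℝ E] [NormedAddCommGroup F] [NormedSpace ℝ F] :
    C(K, E →L[ℝ] F) →L[ℝ] C(K, E) →L[ℝ] C(K, F) :=
  LinearMap.mkContinuous₂
    (LinearMap.mk₂ ℝ (fun (A : C(K, E →L[ℝ] F)) (g : C(K, E)) =>
        (⟨fun k => A k (g k), by fun_prop⟩ : C(K, F)))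
      (by intros; ext; simp) (by intros; ext; simp)
      (by intros; ext; simp) (by intros; ext; simp)) 1
    (by
      intro A g
      rw [ContinuousMap.norm_le _ (by positivity)]
      intro k
      simp only [LinearMap.mk₂_apply, ContinuousMap.coe_mk, one_mul]
      exact (A k).le_of_opNorm_le_of_le (A.norm_coe_le_norm k) (g.norm_coe_le_norm k))

theorem pwApply_apply {K E F : Type} [TopologicalSpace K] [CompactSpace K]
    [NormedAddCommGroup E] [NormedSpace ℝ E] [NormedAddCommGroup F] [NormedSpace ℝ F]
    (A : C(K, E →L[ℝ] F)) (g : C(K, E)) (k : K) : pwApply K E F A g k = A k (g k) := rfl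

theorem postc_continuous {K E F : Type} [TopologicalSpace K] [CompactSpace K]
    [NormedAddCommGroup E] [NormedSpace ℝ E] [NormedAddCommGroup F] [NormedSpace ℝ F]
    (f : E → F) (hf : Continuous f) : Continuous (postc (K := K) f hf) :=
  ContinuousMap.continuous_postcomp _

theorem postc_hasFDerivAt {K E F : Type} [TopologicalSpace K] [CompactSpace K]
    [NormedAddCommGroup E] [NormedSpace ℝ E] [NormedAddCommGroup F] [NormedSpace ℝ F]
    (f : E → F) (hf : Continuous f) (hd : Differentiable ℝ f) (hf' : Continuous (fderiv ℝ f))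
    (γ : C(K, E)) :
    HasFDerivAt (postc (K := K) f hf) (pwApply K E F (postc (fderiv ℝ f) hf' γ)) γ := by
  rw [hasFDerivAt_iff_isLittleO, Asymptotics.isLittleO_iff]
  intro c hc
  have hcont := (postc_continuous (K := K) (fderiv ℝ f) hf').continuousAt (x := γ)
  rw [Metric.continuousAt_iff] at hcont
  obtain ⟨δ, hδ, H⟩ := hcont c hc
  filter_upwards [Metric.ball_mem_nhds γ hδ] with η hη
  rw [ContinuousMap.norm_le _ (by positivity)]
  intro k
  have key : ‖f (η k) - f (γ k) - fderiv ℝ f (γ k) (η k - γ k)‖ ≤ c * ‖η k - γ k‖ := by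
    refine (convex_segment (γ k) (η k)).norm_image_sub_le_of_norm_fderiv_le' (𝕜 := ℝ)
      (fun x _ => hd x) ?_ (left_mem_segment ℝ _ _) (right_mem_segment ℝ _ _)
    intro x hx
    rw [segment_eq_image'] at hx
    obtain ⟨θ, hθ, rfl⟩ := hx
    have h1 : dist (γ + θ • (η - γ)) γ < δ := by
      rw [dist_eq_norm, add_sub_cancel_left, norm_smul, Real.norm_of_nonneg hθ.1]
      rw [Metric.mem_ball, dist_eq_norm] at hη
      exact lt_of_le_of_lt (mul_le_of_le_one_left (norm_nonneg _) hθ.2) hη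
    have h2 := (H h1).le
    rw [dist_eq_norm] at h2
    have h3 := (ContinuousMap.norm_coe_le_norm _ k).trans h2
    exact h3
  refine key.trans ?_
  have := (η - γ).norm_coe_le_norm k
  exact mul_le_mul_of_nonneg_left this hc.le

theorem postc_contDiff {K E : Type} [TopologicalSpace K] [CompactSpace K]
    [NormedAddCommGroup E] [NormedSpace ℝ E] (n : ℕ) :
    ∀ (F : Type) [NormedAddCommGroup F] [NormedSpace ℝ F]
    (f : E → F) (hf : Continuous f) (_ : ContDiff ℝ n f),
    ContDiff ℝ n (postc (K := K) f hf) := by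
  induction n with
  | zero =>
    intro F _ _ f hf _
    exact contDiff_zero.2 (postc_continuous f hf)
  | succ n ih =>
    intro F _ _ f hf h
    push_cast at h ⊢
    have h2 := (contDiff_succ_iff_fderiv.1 h)
    rw [contDiff_succ_iff_hasFDerivAt]
    refine ⟨fun γ => pwApply K E F (postc (fderiv ℝ f) h2.2.2.continuous γ), ?_, fun γ =>
      postc_hasFDerivAt f hf h2.1 h2.2.2.continuous γ⟩
    exact (pwApply K E F).contDiff.comp (ih _ (fderiv ℝ f) h2.2.2.continuous h2.2.2)

end OmegaLemma

section Flow

set_option linter.unusedSectionVars false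

open Set Filter Topology

variable {E : Type} [NormedAddCommGroup E] [NormedSpace ℝ E] [CompleteSpace E]

/-- A continuous curve on the unit interval, extended to the line. -/
def extC (g : C(Icc (0 : ℝ) 1, E)) (u : ℝ) : E := g (projIcc 0 1 zero_le_one u)

theorem extC_continuous (g : C(Icc (0 : ℝ) 1, E)) : Continuous (extC g) :=
  g.continuous.comp continuous_projIcc

theorem extC_prim_continuous (g : C(Icc (0 : ℝ) 1, E)) :
    Continuous fun s : ℝ => ∫ u in (0 : ℝ)..s, extC g u :=
  intervalIntegral.continuous_primitive
    (fun _ _ => (extC_continuous g).intervalIntegrable _ _) 0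

/-- The integration operator. -/
def integOp (E : Type) [NormedAddCommGroup E] [NormedSpace ℝ E] [CompleteSpace E] :
    C(Icc (0 : ℝ) 1, E) →L[ℝ] C(Icc (0 : ℝ) 1, E) :=
  LinearMap.mkContinuous
    { toFun := fun g => ⟨fun s => ∫ u in (0 : ℝ)..s, extC g u,
        (extC_prim_continuous g).comp continuous_subtype_val⟩
      map_add' := by
        intro g h
        ext s
        exact intervalIntegral.integral_add ((extC_continuous g).intervalIntegrable _ _)
          ((extC_continuous h).intervalIntegrable _ _)
      map_smul' := by
        intro c g
        ext s
        exact intervalIntegral.integral_smul c _ } 1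
    (by
      intro g
      rw [ContinuousMap.norm_le _ (by positivity)]
      rintro ⟨s, hs0, hs1⟩
      have := intervalIntegral.norm_integral_le_of_norm_le_const (a := (0 : ℝ)) (b := s)
        (f := extC g) (C := ‖g‖) (fun u _ => g.norm_coe_le_norm _)
      refine this.trans ?_
      rw [sub_zero, abs_of_nonneg hs0, one_mul]
      exact mul_le_of_le_one_right (norm_nonneg _) hs1)

theorem integOp_apply (g : C(Icc (0 : ℝ) 1, E)) (s : Icc (0 : ℝ) 1) :
    integOp E g s = ∫ u in (0 : ℝ)..s, extC g u := rfl

/-- Uniqueness of solutions on the unit interval. -/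
theorem ode_unique (R : E → E) (hR : ContDiff ℝ 1 R) (f g : ℝ → E) (c : ℝ)
    (hf : ContinuousOn f (Icc 0 1)) (hg : ContinuousOn g (Icc 0 1))
    (hf' : ∀ s ∈ Icc (0 : ℝ) 1, HasDerivAt f (c • R (f s)) s)
    (hg' : ∀ s ∈ Icc (0 : ℝ) 1, HasDerivAt g (c • R (g s)) s)
    (h0 : f 0 = g 0) : f 1 = g 1 := by
  have hc : IsCompact (f '' Icc 0 1 ∪ g '' Icc 0 1) :=
    (isCompact_Icc.image_of_continuousOn hf).union (isCompact_Icc.image_of_continuousOn hg)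
  have hR' : ContDiff ℝ 1 (fun x => c • R x) := contDiff_const.smul hR
  obtain ⟨K, hK⟩ := LocallyLipschitzOn.exists_lipschitzOnWith_of_compact hc
    (hR'.locallyLipschitz.locallyLipschitzOn (s := (f '' Icc 0 1 ∪ g '' Icc 0 1)))
  refine ODE_solution_unique_of_mem_Icc_right (a := 0) (b := 1) (v := fun _ x => c • R x) (K := K)
    (s := fun _ => (f '' Icc 0 1 ∪ g '' Icc 0 1))
    (fun _ _ => hK) hf ?_ ?_ hg ?_ ?_ h0 (right_mem_Icc.2 zero_le_one)
  · exact fun t ht => (hf' t (Ico_subset_Icc_self ht)).hasDerivWithinAt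
  · exact fun t ht => Or.inl (mem_image_of_mem _ (Ico_subset_Icc_self ht))
  · exact fun t ht => (hg' t (Ico_subset_Icc_self ht)).hasDerivWithinAt
  · exact fun t ht => Or.inr (mem_image_of_mem _ (Ico_subset_Icc_self ht))

theorem flow_scaled (R : E → E) (Φ : ℝ → E → E)
    (hΦ : ∀ p t, HasDerivAt (fun u => Φ u p) (R (Φ t p)) t) (c d : ℝ) (p : E) (s : ℝ) :
    HasDerivAt (fun u => Φ (u * c + d) p) (c • R (Φ (s * c + d) p)) s := by
  have h1 : HasDerivAt (fun u : ℝ => u * c + d) c s := by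
    simpa using ((hasDerivAt_id s).mul_const c).add_const d
  exact HasDerivAt.scomp s (hΦ p (s * c + d)) h1

theorem flow_add (R : E → E) (hR : ContDiff ℝ 1 R) (Φ : ℝ → E → E) (h0 : ∀ p, Φ 0 p = p)
    (hΦ : ∀ p t, HasDerivAt (fun u => Φ u p) (R (Φ t p)) t) (t s : ℝ) (p : E) :
    Φ (t + s) p = Φ t (Φ s p) := by
  have := ode_unique R hR (fun u => Φ (u * t + s) p) (fun u => Φ (u * t + 0) (Φ s p)) t
    (fun u _ => (flow_scaled R Φ hΦ t s p u).continuousAt.continuousWithinAt)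
    (fun u _ => (flow_scaled R Φ hΦ t 0 _ u).continuousAt.continuousWithinAt)
    (fun u _ => flow_scaled R Φ hΦ t s p u)
    (fun u _ => flow_scaled R Φ hΦ t 0 _ u) (by simp [h0])
  simpa using this

theorem flow_smooth_zero (R : E → E) (n : ℕ) (hn : 1 ≤ n) (hR : ContDiff ℝ n R)
    (Φ : ℝ → E → E) (h0 : ∀ p, Φ 0 p = p)
    (hΦ : ∀ p t, HasDerivAt (fun u => Φ u p) (R (Φ t p)) t) (p : E) :
    ContDiffAt ℝ n (fun z : ℝ × E => Φ z.1 z.2) (0, p) := by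
  have hn' : (n : WithTop ℕ∞) ≠ 0 := by
    have : n ≠ 0 := by omega
    exact_mod_cast this
  have hR1 : ContDiff ℝ 1 R := hR.of_le (by exact_mod_cast hn)
  let X := C(Icc (0 : ℝ) 1, E)
  let N : X → X := fun γ => integOp E (postc R hR.continuous γ)
  have hN : ContDiff ℝ n N := (integOp E).contDiff.comp (postc_contDiff n E R hR.continuous hR)
  let H : ℝ × X → ℝ × X := fun z => (z.1, z.2 - z.1 • N z.2)
  have hH : ContDiff ℝ n H :=
    contDiff_fst.prodMk (contDiff_snd.sub (contDiff_fst.smul (hN.comp contDiff_snd)))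
  let cst : E →L[ℝ] X := ContinuousLinearMap.const ℝ (Icc (0 : ℝ) 1)
  let a : ℝ × X := (0, cst p)
  let w : X := N (cst p)
  let T : (ℝ × X) ≃L[ℝ] (ℝ × X) := ContinuousLinearEquiv.equivOfInverse
    ((ContinuousLinearMap.fst ℝ ℝ X).prod
      (ContinuousLinearMap.snd ℝ ℝ X - (ContinuousLinearMap.fst ℝ ℝ X).smulRight w))
    ((ContinuousLinearMap.fst ℝ ℝ X).prod
      (ContinuousLinearMap.snd ℝ ℝ X + (ContinuousLinearMap.fst ℝ ℝ X).smulRight w))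
    (by intro z; ext <;> simp) (by intro z; ext <;> simp)
  have hT : HasFDerivAt H (T : (ℝ × X) →L[ℝ] (ℝ × X)) a := by
    have hNd : HasFDerivAt (fun z : ℝ × X => N z.2)
        ((fderiv ℝ N (cst p)).comp (ContinuousLinearMap.snd ℝ ℝ X)) a :=
      HasFDerivAt.comp (g := N) (f := fun z : ℝ × X => z.2) a
        ((hN.differentiable hn' (cst p)).hasFDerivAt) hasFDerivAt_snd
    have := (hasFDerivAt_fst (𝕜 := ℝ) (p := a)).prodMk
      ((hasFDerivAt_snd (𝕜 := ℝ) (p := a)).sub ((hasFDerivAt_fst (𝕜 := ℝ) (p := a)).smul hNd))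
    refine this.congr_fderiv ?_
    ext z <;> simp [T, a, w]
  have hHa := hH.contDiffAt (x := a)
  let σ := hHa.localInverse hT hn'
  have hσ : ContDiffAt ℝ n σ (H a) := hHa.to_localInverse hT hn'
  have hinv : ∀ᶠ y in 𝓝 (H a), H (σ y) = y :=
    (hHa.hasStrictFDerivAt' hT hn').eventually_right_inverse
  have hHaeq : H a = (0, cst p) := by simp [H, a]
  let ι : ℝ × E → ℝ × X := fun z => (z.1, cst z.2)
  have hι : ContDiff ℝ n ι := contDiff_fst.prodMk (cst.contDiff.comp contDiff_snd)
  have hι0 : ι (0, p) = H a := by rw [hHaeq]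
  let ev : X →L[ℝ] E := ContinuousMap.evalCLM ℝ (⟨1, by simp⟩ : Icc (0 : ℝ) 1)
  have hcd : ContDiffAt ℝ n (fun z => ev (σ (ι z)).2) (0, p) := by
    have h1 : ContDiffAt ℝ n (fun z => σ (ι z)) (0, p) :=
      ContDiffAt.comp (0, p) (hι0 ▸ hσ) hι.contDiffAt
    exact ev.contDiff.contDiffAt.comp _ (contDiffAt_snd.comp _ h1)
  refine hcd.congr_of_eventuallyEq ?_
  have hev : ∀ᶠ z in 𝓝 ((0 : ℝ), p), H (σ (ι z)) = ι z :=
    (hι.continuous.tendsto (0, p)).eventually (hι0 ▸ hinv)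
  filter_upwards [hev] with z hz
  obtain ⟨t, x⟩ := z
  generalize hy : σ (ι (t, x)) = y at hz
  obtain ⟨t', γ⟩ := y
  have e1 : t' = t := congrArg Prod.fst hz
  subst e1
  have e2 : γ - t' • N γ = cst x := congrArg Prod.snd hz
  have e3 : ∀ s : Icc (0 : ℝ) 1,
      γ s = x + t' • ∫ u in (0 : ℝ)..s, extC (postc R hR.continuous γ) u := by
    intro s
    have := congrArg (fun g : X => g s) e2
    have h' : γ s - t' • (∫ u in (0 : ℝ)..s, extC (postc R hR.continuous γ) u) = x := this
    rw [← h']; abel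
  let g : ℝ → E := fun s => x + t' • ∫ u in (0 : ℝ)..s, extC (postc R hR.continuous γ) u
  have hg : ∀ s ∈ Icc (0 : ℝ) 1, HasDerivAt g (t' • R (g s)) s := by
    intro s hs
    have h1 : HasDerivAt (fun s => ∫ u in (0 : ℝ)..s, extC (postc R hR.continuous γ) u)
        (extC (postc R hR.continuous γ) s) s :=
      intervalIntegral.integral_hasDerivAt_right
        ((extC_continuous _).intervalIntegrable _ _)
        ((extC_continuous _).stronglyMeasurableAtFilter _ _) (extC_continuous _).continuousAt
    have h2 := (h1.const_smul t').const_add x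
    have h3 : extC (postc R hR.continuous γ) s = R (g s) := by
      have : R (γ ⟨s, hs⟩) = R (g s) := by rw [e3]
      rw [← this]
      simp only [extC, projIcc_of_mem zero_le_one hs]
      rfl
    rw [← h3]
    exact h2
  have hfin := ode_unique R hR1 (fun u => Φ (u * t' + 0) x) g t'
    (fun u _ => (flow_scaled R Φ hΦ t' 0 x u).continuousAt.continuousWithinAt)
    (fun u hu => (hg u hu).continuousAt.continuousWithinAt)
    (fun u _ => flow_scaled R Φ hΦ t' 0 x u) hg (by simp [h0, g])
  have h4 : ev γ = g 1 := e3 ⟨1, by simp⟩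
  simp only [one_mul, add_zero] at hfin
  simp only [h4, ← hfin]

theorem flow_smooth (R : E → E) (n : ℕ) (hn : 1 ≤ n) (hR : ContDiff ℝ n R)
    (Φ : ℝ → E → E) (h0 : ∀ p, Φ 0 p = p)
    (hΦ : ∀ p t, HasDerivAt (fun u => Φ u p) (R (Φ t p)) t) :
    ContDiff ℝ n (fun z : ℝ × E => Φ z.1 z.2) := by
  have hR1 : ContDiff ℝ 1 R := hR.of_le (by exact_mod_cast hn)
  rw [contDiff_iff_contDiffAt]
  rintro ⟨t₀, p⟩
  let S : Set ℝ := {t | ContDiffAt ℝ n (fun z : ℝ × E => Φ z.1 z.2) (t, p)}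
  have hcont : ∀ x, Continuous fun u => Φ u x := fun x =>
    continuous_iff_continuousAt.2 fun t => (hΦ x t).continuousAt
  have hne : (n : WithTop ℕ∞) ≠ (⊤ : ℕ∞) := by
    intro h
    have : (n : ℕ∞) = ⊤ := by exact_mod_cast h
    exact ENat.natCast_ne_top n this
  have hopen : IsOpen S := by
    rw [isOpen_iff_mem_nhds]
    intro t ht
    have h1 : ∀ᶠ z in 𝓝 (t, p), ContDiffAt ℝ n (fun z : ℝ × E => Φ z.1 z.2) z :=
      ContDiffAt.eventually ht hne
    have h2 : Tendsto (fun u : ℝ => (u, p)) (𝓝 t) (𝓝 (t, p)) :=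
      Continuous.tendsto (by fun_prop) t
    exact h2.eventually h1
  have hclosed : IsClosed S := by
    rw [← closure_subset_iff_isClosed]
    intro t ht
    have h1 := (flow_smooth_zero R n hn hR Φ h0 hΦ (Φ t p)).eventually hne
    have h2 : Tendsto (fun u : ℝ => (t - u, Φ u p)) (𝓝 t) (𝓝 (0, Φ t p)) := by
      have : Continuous (fun u : ℝ => (t - u, Φ u p)) :=
        (continuous_const.sub continuous_id).prodMk (hcont p)
      simpa using this.tendsto t
    have h3 := h2.eventually h1
    obtain ⟨u, hu1, hu2⟩ := mem_closure_iff_nhds.1 ht _ h3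
    have hu2' : ContDiffAt ℝ n (fun z : ℝ × E => Φ z.1 z.2) (u, p) := hu2
    have hu1' : ContDiffAt ℝ n (fun z : ℝ × E => Φ z.1 z.2) (t - u, Φ u p) := hu1
    have h4 : ContDiffAt ℝ n (fun z : ℝ × E => Φ u z.2) (t, p) := by
      have : ContDiffAt ℝ n (fun z : ℝ × E => ((u, z.2) : ℝ × E)) (t, p) :=
        contDiffAt_const.prodMk contDiffAt_snd
      exact ContDiffAt.comp (t, p) (f := fun z : ℝ × E => ((u, z.2) : ℝ × E))
        (g := fun z : ℝ × E => Φ z.1 z.2) hu2' this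
    have h5 : ContDiffAt ℝ n (fun z : ℝ × E => (z.1 - u, Φ u z.2)) (t, p) :=
      (contDiffAt_fst.sub contDiffAt_const).prodMk h4
    have h6 := ContDiffAt.comp (t, p) (f := fun z : ℝ × E => (z.1 - u, Φ u z.2))
        (g := fun z : ℝ × E => Φ z.1 z.2) hu1' h5
    refine h6.congr_of_eventuallyEq (Eventually.of_forall fun z => ?_)
    simp only [Function.comp]
    rw [← flow_add R hR1 Φ h0 hΦ]
    simp
  have huniv : S = univ := IsClopen.eq_univ ⟨hclosed, hopen⟩ ⟨0, flow_smooth_zero R n hn hR Φ h0 hΦ p⟩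
  have : t₀ ∈ S := huniv ▸ mem_univ _
  exact this

end Flow

section Reeb

theorem V3_decomp (v : V3) : v = v 0 • e3 0 + v 1 • e3 1 + v 2 • e3 2 := by
  ext i
  fin_cases i <;> simp [e3]

theorem reeb_formula (α : V3 → V3 →L[ℝ] ℝ) (R : V3 → V3)
    (hR1 : ∀ p, α p (R p) = 1) (hR2 : ∀ p v, d2 α p (R p) v = 0) (p : V3) :
    let D := α p (e3 0) * d2 α p (e3 1) (e3 2)
      - α p (e3 1) * d2 α p (e3 0) (e3 2) + α p (e3 2) * d2 α p (e3 0) (e3 1)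
    R p 0 * D = d2 α p (e3 1) (e3 2) ∧ R p 1 * D = - d2 α p (e3 0) (e3 2) ∧
      R p 2 * D = d2 α p (e3 0) (e3 1) := by
  intro D
  have h1 := hR1 p
  have a0 := hR2 p (e3 0)
  have a1 := hR2 p (e3 1)
  have a2 := hR2 p (e3 2)
  rw [V3_decomp (R p)] at h1 a0 a1 a2
  simp only [d2, map_add, map_smul, smul_eq_mul, add_apply,
    smul_apply] at h1 a0 a1 a2
  simp only [D, d2]
  generalize R p 0 = r0 at *
  generalize R p 1 = r1 at *
  generalize R p 2 = r2 at *
  refine ⟨?_, ?_, ?_⟩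
  · linear_combination (fderiv ℝ α p (e3 1) (e3 2) - fderiv ℝ α p (e3 2) (e3 1)) * h1
      - α p (e3 1) * a2 + α p (e3 2) * a1
  · linear_combination -(fderiv ℝ α p (e3 0) (e3 2) - fderiv ℝ α p (e3 2) (e3 0)) * h1
      + α p (e3 0) * a2 - α p (e3 2) * a0
  · linear_combination (fderiv ℝ α p (e3 0) (e3 1) - fderiv ℝ α p (e3 1) (e3 0)) * h1
      - α p (e3 0) * a1 + α p (e3 1) * a0

theorem d2_smooth (α : V3 → V3 →L[ℝ] ℝ) (hα : ContDiff ℝ (⊤ : ℕ∞) α) (v w : V3) :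
    ContDiff ℝ (⊤ : ℕ∞) fun p => d2 α p v w := by
  have h : ContDiff ℝ (⊤ : ℕ∞) (fderiv ℝ α) := hα.fderiv_right (by simp)
  unfold d2
  exact ((h.clm_apply contDiff_const).clm_apply contDiff_const).sub
    ((h.clm_apply contDiff_const).clm_apply contDiff_const)

theorem reeb_smooth (α : V3 → V3 →L[ℝ] ℝ) (hα : IsContactForm3 α) (R : V3 → V3)
    (hR1 : ∀ p, α p (R p) = 1) (hR2 : ∀ p v, d2 α p (R p) v = 0) :
    ContDiff ℝ (⊤ : ℕ∞) R := by
  obtain ⟨hs, hne⟩ := hα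
  have hd := d2_smooth α hs
  have ha : ∀ i, ContDiff ℝ (⊤ : ℕ∞) fun p => α p (e3 i) := fun i => hs.clm_apply contDiff_const
  have hD := (((ha 0).mul (hd (e3 1) (e3 2))).sub ((ha 1).mul (hd (e3 0) (e3 2)))).add
    ((ha 2).mul (hd (e3 0) (e3 1)))
  have hf := reeb_formula α R hR1 hR2
  rw [contDiff_pi]
  intro i
  fin_cases i
  · have e : (fun p => R p 0) = fun p => d2 α p (e3 1) (e3 2) / (α p (e3 0) * d2 α p (e3 1) (e3 2)
        - α p (e3 1) * d2 α p (e3 0) (e3 2) + α p (e3 2) * d2 α p (e3 0) (e3 1)) :=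
      funext fun p => eq_div_of_mul_eq (hne p) (hf p).1
    change ContDiff ℝ (⊤ : ℕ∞) (fun p => R p 0)
    rw [e]
    exact (hd (e3 1) (e3 2)).div hD hne
  · have e : (fun p => R p 1) = fun p => (-d2 α p (e3 0) (e3 2)) / (α p (e3 0) * d2 α p (e3 1) (e3 2)
        - α p (e3 1) * d2 α p (e3 0) (e3 2) + α p (e3 2) * d2 α p (e3 0) (e3 1)) :=
      funext fun p => eq_div_of_mul_eq (hne p) (hf p).2.1
    change ContDiff ℝ (⊤ : ℕ∞) (fun p => R p 1)
    rw [e]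
    exact (hd (e3 0) (e3 2)).neg.div hD hne
  · have e : (fun p => R p 2) = fun p => d2 α p (e3 0) (e3 1) / (α p (e3 0) * d2 α p (e3 1) (e3 2)
        - α p (e3 1) * d2 α p (e3 0) (e3 2) + α p (e3 2) * d2 α p (e3 0) (e3 1)) :=
      funext fun p => eq_div_of_mul_eq (hne p) (hf p).2.2
    change ContDiff ℝ (⊤ : ℕ∞) (fun p => R p 2)
    rw [e]
    exact (hd (e3 0) (e3 1)).div hD hne

/-- The Reeb flow preserves `α`. -/
theorem flow_preserves (α : V3 → V3 →L[ℝ] ℝ) (hα : ContDiff ℝ (⊤ : ℕ∞) α) (R : V3 → V3)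
    (hR : ContDiff ℝ (⊤ : ℕ∞) R)
    (hR1 : ∀ p, α p (R p) = 1) (hR2 : ∀ p v, d2 α p (R p) v = 0)
    (Φ : ℝ → V3 → V3) (h0 : ∀ p, Φ 0 p = p)
    (hΦ : ∀ p t, HasDerivAt (fun u => Φ u p) (R (Φ t p)) t)
    (F : ℝ × V3 → V3) (hF : F = fun z => Φ z.1 z.2) (hFs : ContDiff ℝ (⊤ : ℕ∞) F)
    (hF1 : ∀ z, fderiv ℝ F z (1, 0) = R (F z)) (t : ℝ) (p v : V3) :
    α (F (t, p)) (fderiv ℝ F (t, p) (0, v)) = α p v := by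
  have hFd : Differentiable ℝ F := hFs.differentiable (by simp)
  have hαd : Differentiable ℝ α := hα.differentiable (by simp)
  have hRd : Differentiable ℝ R := hR.differentiable (by simp)
  have hF's : ContDiff ℝ (⊤ : ℕ∞) (fderiv ℝ F) := hFs.fderiv_right (by simp)
  have hF'd : Differentiable ℝ (fderiv ℝ F) := hF's.differentiable (by simp)
  have hline : ∀ u : ℝ, HasDerivAt (fun u : ℝ => ((u, p) : ℝ × V3)) (1, 0) u := fun u =>
    (hasDerivAt_id u).prodMk (hasDerivAt_const u p)
  have hFu : ∀ u, HasDerivAt (fun u => F (u, p)) (R (F (u, p))) u := by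
    intro u
    rw [hF]; exact hΦ p u
  -- the variational equation
  have hW : ∀ u, HasDerivAt (fun u => fderiv ℝ F (u, p) (0, v))
      (fderiv ℝ R (F (u, p)) (fderiv ℝ F (u, p) (0, v))) u := by
    intro u
    have h1 : HasDerivAt (fun u => fderiv ℝ F (u, p)) (fderiv ℝ (fderiv ℝ F) (u, p) (1, 0)) u :=
      (hF'd (u, p)).hasFDerivAt.comp_hasDerivAt u (hline u)
    have h2 := h1.clm_apply (hasDerivAt_const u ((0, v) : ℝ × V3))
    have hsymm : fderiv ℝ (fderiv ℝ F) (u, p) (1, 0) (0, v)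
        = fderiv ℝ (fderiv ℝ F) (u, p) (0, v) (1, 0) := by
      have := (hFs.contDiffAt (x := (u, p))).isSymmSndFDerivAt
        (by rw [minSmoothness_of_isRCLikeNormedField]
            exact WithTop.coe_le_coe.2 (le_top : (2 : ℕ∞) ≤ ⊤))
      exact this.eq _ _
    have h3 : fderiv ℝ (fderiv ℝ F) (u, p) (0, v) (1, 0)
        = fderiv ℝ R (F (u, p)) (fderiv ℝ F (u, p) (0, v)) := by
      have ea : HasFDerivAt (fun z => fderiv ℝ F z (1, 0))
          ((fderiv ℝ (fderiv ℝ F) (u, p)).flip (1, 0)) (u, p) := by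
        have := (hF'd (u, p)).hasFDerivAt.clm_apply (hasFDerivAt_const ((1, 0) : ℝ × V3) (u, p))
        refine this.congr_fderiv ?_
        ext <;> simp
      have eb : HasFDerivAt (fun z => R (F z))
          ((fderiv ℝ R (F (u, p))).comp (fderiv ℝ F (u, p))) (u, p) :=
        (hRd _).hasFDerivAt.comp (u, p) (hFd _).hasFDerivAt
      have ec : (fun z => fderiv ℝ F z (1, 0)) = fun z => R (F z) := funext hF1
      rw [ec] at ea
      have := ea.unique eb
      exact congrArg (fun L : (ℝ × V3) →L[ℝ] V3 => L (0, v)) this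
    rw [hsymm, h3] at h2
    simpa using h2
  have hder : ∀ u, HasDerivAt (fun u => α (F (u, p)) (fderiv ℝ F (u, p) (0, v))) 0 u := by
    intro u
    have h1 : HasDerivAt (fun u => α (F (u, p))) (fderiv ℝ α (F (u, p)) (R (F (u, p)))) u :=
      (hαd _).hasFDerivAt.comp_hasDerivAt u (hFu u)
    have h2 := h1.clm_apply (hW u)
    refine h2.congr_deriv ?_
    generalize fderiv ℝ F (u, p) (0, v) = w
    generalize F (u, p) = q
    have h3 : HasFDerivAt (fun x => α x (R x))
        ((α q).comp (fderiv ℝ R q) + (fderiv ℝ α q).flip (R q)) q :=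
      (hαd q).hasFDerivAt.clm_apply (hRd q).hasFDerivAt
    have h4 : (fun x => α x (R x)) = fun _ => (1 : ℝ) := funext hR1
    rw [h4] at h3
    have h5 := congrArg (fun L : V3 →L[ℝ] ℝ => L w) (h3.unique (hasFDerivAt_const 1 q))
    simp at h5
    have h6 := hR2 q w
    unfold d2 at h6
    linarith
  have hconst := is_const_of_deriv_eq_zero (fun u => (hder u).differentiableAt)
    (fun u => (hder u).deriv) t 0
  rw [hconst]
  have hF0 : ∀ x, F (0, x) = x := by intro x; rw [hF]; exact h0 x
  have h7 : fderiv ℝ F (0, p) (0, v) = v := by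
    have e1 : HasFDerivAt (fun x : V3 => ((0, x) : ℝ × V3)) (ContinuousLinearMap.inr ℝ ℝ V3) p :=
      hasFDerivAt_prodMk_right 0 p
    have e2 : HasFDerivAt (fun x => F (0, x))
        ((fderiv ℝ F (0, p)).comp (ContinuousLinearMap.inr ℝ ℝ V3)) p :=
      HasFDerivAt.comp (f := fun x : V3 => ((0, x) : ℝ × V3)) (g := F) p
        (hFd (0, p)).hasFDerivAt e1
    have e3 : (fun x => F (0, x)) = id := funext hF0
    rw [e3] at e2
    have := congrArg (fun L : V3 →L[ℝ] V3 => L v) (e2.unique (hasFDerivAt_id p))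
    simpa using this
  rw [h7, hF0]

end Reeb

theorem disk_embeds_into_contactization_of_symplectization
    (α : V3 → V3 →L[ℝ] ℝ) (hα : IsContactForm3 α)
    (R : V3 → V3)
    (hR1 : ∀ p, α p (R p) = 1) (hR2 : ∀ p v, d2 α p (R p) v = 0)
    (hRcomplete : ∃ Φ : ℝ → V3 → V3, (∀ p, Φ 0 p = p) ∧
      ∀ p t, HasDerivAt (fun u => Φ u p) (R (Φ t p)) t) :
    ∀ R₀ : ℝ, 0 < R₀ →
      ∃ φ : V3 × ℝ × ℝ → V3 × ℝ × ℝ, ∃ Ω : Set (V3 × ℝ × ℝ),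
        IsOpen Ω ∧ diskS R₀ ⊆ Ω ∧ ContDiffOn ℝ (⊤ : ℕ∞) φ Ω ∧
        Set.InjOn φ (diskS R₀) ∧ Set.MapsTo φ (diskS R₀) posT ∧
        (∀ q ∈ diskS R₀, Function.Injective (fderiv ℝ φ q)) ∧
        ∃ h : V3 × ℝ × ℝ → ℝ, (∀ q ∈ diskS R₀, h q ≠ 0) ∧
          -- φ*(tα - ds) = h · (α + r²dθ)
          ∀ q ∈ diskS R₀, ∀ v : V3 × ℝ × ℝ,
            (φ q).2.1 * α (φ q).1 (fderiv ℝ φ q v).1 - (fderiv ℝ φ q v).2.2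
              = h q * (α q.1 v.1 + (q.2.1 * v.2.2 - q.2.2 * v.2.1)) := by
  obtain ⟨Φ, h0, hΦ⟩ := hRcomplete
  intro R₀ hR₀
  have hRs := reeb_smooth α hα R hR1 hR2
  obtain ⟨F, hF⟩ : ∃ F : ℝ × V3 → V3, F = fun z => Φ z.1 z.2 := ⟨_, rfl⟩
  have hFs : ContDiff ℝ (⊤ : ℕ∞) F := by
    rw [contDiff_infty]
    intro n
    have := flow_smooth R (n + 1) (by omega)
      (hRs.of_le (by exact_mod_cast le_top)) Φ h0 hΦ
    rw [← hF] at this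
    exact this.of_le (by exact_mod_cast Nat.le_succ n)
  have hFd : Differentiable ℝ F := hFs.differentiable (by simp)
  have hF1 : ∀ z, fderiv ℝ F z (1, 0) = R (F z) := by
    rintro ⟨u, p⟩
    have h1 : HasDerivAt (fun u : ℝ => ((u, p) : ℝ × V3)) (1, 0) u :=
      (hasDerivAt_id u).prodMk (hasDerivAt_const u p)
    have h2 : HasDerivAt (fun u => F (u, p)) (fderiv ℝ F (u, p) (1, 0)) u :=
      (hFd (u, p)).hasFDerivAt.comp_hasDerivAt u h1
    have h3 : HasDerivAt (fun u => F (u, p)) (R (F (u, p))) u := by rw [hF]; exact hΦ p u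
    exact h2.unique h3
  have hpres := flow_preserves α hα.1 R hRs hR1 hR2 Φ h0 hΦ F hF hFs hF1
  have hback : ∀ t x, F (-t, F (t, x)) = x := by
    intro t x
    rw [hF]
    simp only
    rw [← flow_add R (hRs.of_le (by exact_mod_cast le_top)) Φ h0 hΦ]
    simp [h0]
  have hinjF : ∀ t p v, fderiv ℝ F (t, p) (0, v) = 0 → v = 0 := by
    intro t p v hv
    have e1 : HasFDerivAt (fun x : V3 => ((t, x) : ℝ × V3)) (ContinuousLinearMap.inr ℝ ℝ V3) p :=
      hasFDerivAt_prodMk_right t p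
    have e2 : HasFDerivAt (fun x => F (t, x))
        ((fderiv ℝ F (t, p)).comp (ContinuousLinearMap.inr ℝ ℝ V3)) p :=
      HasFDerivAt.comp (f := fun x : V3 => ((t, x) : ℝ × V3)) (g := F) p
        (hFd (t, p)).hasFDerivAt e1
    have e3 : HasFDerivAt (fun x : V3 => ((-t, x) : ℝ × V3)) (ContinuousLinearMap.inr ℝ ℝ V3)
        (F (t, p)) := hasFDerivAt_prodMk_right (-t) _
    have e4 : HasFDerivAt (fun x => F (-t, x))
        ((fderiv ℝ F (-t, F (t, p))).comp (ContinuousLinearMap.inr ℝ ℝ V3)) (F (t, p)) :=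
      HasFDerivAt.comp (f := fun x : V3 => ((-t, x) : ℝ × V3)) (g := F) _
        (hFd _).hasFDerivAt e3
    have e5 := HasFDerivAt.comp (f := fun x => F (t, x)) (g := fun x => F (-t, x)) p e4 e2
    have e6 : ((fun x => F (-t, x)) ∘ fun x => F (t, x)) = id := funext (hback t)
    rw [e6] at e5
    have := congrArg (fun L : V3 →L[ℝ] V3 => L v) (e5.unique (hasFDerivAt_id p))
    simp [hv] at this
    rw [show ((0, 0) : ℝ × V3) = 0 from rfl, map_zero] at this
    exact this.symm
  have hC : ∀ q ∈ diskS R₀, 0 < q.2.2 + (R₀ + 1) := by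
    intro q hq
    have hq' : q.2.1 ^ 2 + q.2.2 ^ 2 ≤ R₀ ^ 2 := hq
    have : -R₀ ≤ q.2.2 := (abs_le.1 (abs_le_of_sq_le_sq (by nlinarith [sq_nonneg q.2.1]) hR₀.le)).1
    linarith
  let C : ℝ := R₀ + 1
  let f : V3 × ℝ × ℝ → ℝ := fun q => q.2.1 * q.2.2 + 2 * C * q.2.1
  let φ : V3 × ℝ × ℝ → V3 × ℝ × ℝ := fun q => (F (f q, q.1), (q.2.2 + C)⁻¹, 2 * q.2.1)
  have hfs : ContDiff ℝ (⊤ : ℕ∞) f := by fun_prop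
  have hder : ∀ q ∈ diskS R₀, ∀ v : V3 × ℝ × ℝ, fderiv ℝ φ q v =
      ((q.2.1 * v.2.2 + q.2.2 * v.2.1 + 2 * C * v.2.1) • R (F (f q, q.1))
        + fderiv ℝ F (f q, q.1) (0, v.1), -v.2.2 / (q.2.2 + C) ^ 2, 2 * v.2.1) := by
    intro q hq v
    have hx : HasFDerivAt (fun q : V3 × ℝ × ℝ => q.2.1)
        ((ContinuousLinearMap.fst ℝ ℝ ℝ).comp (ContinuousLinearMap.snd ℝ V3 (ℝ × ℝ))) q :=
      ContinuousLinearMap.hasFDerivAt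
        ((ContinuousLinearMap.fst ℝ ℝ ℝ).comp (ContinuousLinearMap.snd ℝ V3 (ℝ × ℝ)))
    have hy : HasFDerivAt (fun q : V3 × ℝ × ℝ => q.2.2)
        ((ContinuousLinearMap.snd ℝ ℝ ℝ).comp (ContinuousLinearMap.snd ℝ V3 (ℝ × ℝ))) q :=
      ContinuousLinearMap.hasFDerivAt
        ((ContinuousLinearMap.snd ℝ ℝ ℝ).comp (ContinuousLinearMap.snd ℝ V3 (ℝ × ℝ)))
    have hf : HasFDerivAt f _ q := (hx.mul hy).add (hx.const_mul (2 * C))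
    have hinv := (hasDerivAt_inv (hC q hq).ne').comp_hasFDerivAt q (hy.add_const C)
    have h1 := HasFDerivAt.comp (f := fun q : V3 × ℝ × ℝ => (f q, q.1)) (g := F) q
      (hFd (f q, q.1)).hasFDerivAt (hf.prodMk hasFDerivAt_fst)
    have h2 : HasFDerivAt φ _ q := h1.prodMk (hinv.prodMk (hx.const_mul 2))
    rw [h2.fderiv]
    have hsplit : ∀ (a : ℝ) (w : V3), fderiv ℝ F (f q, q.1) (a, w)
        = a • R (F (f q, q.1)) + fderiv ℝ F (f q, q.1) (0, w) := by
      intro a w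
      have : ((a, w) : ℝ × V3) = a • ((1, 0) : ℝ × V3) + (0, w) := by ext <;> simp
      rw [this, map_add, map_smul, hF1]
    refine Prod.ext ?_ (Prod.ext ?_ ?_)
    · refine Eq.trans (hsplit _ v.1) ?_
      congr 2
    · simp [C]; ring
    · simp
  refine ⟨φ, {q | 0 < q.2.2 + C}, ?_, hC, ?_, ?_, ?_, ?_, fun q => (q.2.2 + C)⁻¹, ?_, ?_⟩
  · exact isOpen_lt continuous_const (by fun_prop)
  · have h1 : ContDiff ℝ (⊤ : ℕ∞) fun q : V3 × ℝ × ℝ => F (f q, q.1) :=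
      hFs.comp (hfs.prodMk contDiff_fst)
    have h2 : ContDiffOn ℝ (⊤ : ℕ∞) (fun q : V3 × ℝ × ℝ => (q.2.2 + C)⁻¹)
        {q | 0 < q.2.2 + C} :=
      ContDiffOn.inv (by fun_prop) (fun q hq => ne_of_gt hq)
    have h3 : ContDiff ℝ (⊤ : ℕ∞) fun q : V3 × ℝ × ℝ => 2 * q.2.1 := by fun_prop
    exact h1.contDiffOn.prodMk (h2.prodMk h3.contDiffOn)
  · rintro ⟨p, x, y⟩ hq ⟨p', x', y'⟩ hq' heq
    simp only [φ, f, Prod.mk.injEq, inv_inj, add_left_inj, mul_eq_mul_left_iff] at heq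
    obtain ⟨e1, e2, e3⟩ := heq
    have e3' : x = x' := by simpa using e3
    subst e2 e3'
    have := congrArg (fun z => F (-(x * y + 2 * C * x), z)) e1
    simp only [hback] at this
    rw [this]
  · intro q hq
    exact inv_pos.2 (hC q hq)
  · intro q hq
    rw [injective_iff_map_eq_zero]
    intro v hv
    rw [hder q hq v] at hv
    obtain ⟨p', x', y'⟩ := v
    simp only [Prod.mk_eq_zero] at hv
    obtain ⟨e1, e2, e3⟩ := hv
    have hx : x' = 0 := by linarith
    have hy : y' = 0 := by
      rcases div_eq_zero_iff.1 e2 with h | h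
      · linarith
      · exact absurd h (pow_ne_zero 2 (hC q hq).ne')
    subst hx hy
    have hp : p' = 0 := hinjF _ _ _ (by simpa using e1)
    simp [hp]
  · intro q hq
    exact inv_ne_zero (hC q hq).ne'
  · intro q hq v
    rw [hder q hq v]
    simp only [φ, map_add, map_smul, smul_eq_mul, hR1, hpres]
    have : q.2.2 + C ≠ 0 := (hC q hq).ne'
    field_simp
    ring
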